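/- Let A be a semiprimary ring, S a simple A-module minimal with respect to the order S' ⪯ S'' iff S' is a direct summand of some syzygy Ω^m S''. Assume Ext_A^n(T,T) = 0 for all simple T and n ≫ 0, and that A/J is semisimple with J^3 = 0. Then S has finite projective dimension. -/

import Mathlib

open CategoryTheory

noncomputable section

instance (A : Type) [Ring A] : HasExt.{1} (ModuleCat.{0} A) := by
  letI := HasDerivedCategory.standard (ModuleCat.{0} A)
  exact hasExt_of_hasDerivedCategory _

/-- The Jacobson radical of the ring `A`, as a two-sided ideal. -/
def jrad (A : Type) [Ring A] : TwoSidedIdeal A := TwoSidedIdeal.jacobson ⊥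

/-- `A/J` is a semisimple ring. -/
def SemisimpleModJ (A : Type) [Ring A] : Prop :=
  IsSemisimpleRing (jrad A).ringCon.Quotient

/-- The Jacobson radical satisfies `J ^ 3 = 0`. -/
def JCubeZero (A : Type) [Ring A] : Prop :=
  ∀ x y z : A, x ∈ jrad A → y ∈ jrad A → z ∈ jrad A → x * y * z = 0

/-- `A` is semiprimary: `A/J` is semisimple and the Jacobson radical `J` is nilpotent. -/
def IsSemiprimary (A : Type) [Ring A] : Prop :=
  SemisimpleModJ A ∧
    ∃ n : ℕ, ∀ x : Fin n → A, (∀ i, x i ∈ jrad A) → (List.ofFn x).prod = 0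

/-- `A/J` as a left `A`-module, an object of `ModuleCat A`. -/
def AmodJ (A : Type) [Ring A] : ModuleCat.{0} A :=
  ModuleCat.of A (A ⧸ (jrad A).asIdeal)

/-- The submodule `J·N`, for `J` the Jacobson radical of `A` and `N` a submodule of `M`. -/
def jSmul (A : Type) [Ring A] {M : Type} [AddCommGroup M] [Module A M]
    (N : Submodule A M) : Submodule A M :=
  Submodule.span A {y | ∃ x ∈ jrad A, ∃ m ∈ N, y = x • m}

/-- `M` has projective dimension at most `n`, characterized by vanishing of
`Ext^k(M, -)` for `k > n`. -/
def projDimLE (A : Type) [Ring A] (M : ModuleCat.{0} A) (n : ℕ) : Prop :=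
  ∀ (N : ModuleCat.{0} A) (k : ℕ), n < k → Subsingleton (Abelian.Ext M N k)

/-- The projective dimension of `M`, valued in `ℕ∞` (infinite if no bound exists). -/
def projDim (A : Type) [Ring A] (M : ModuleCat.{0} A) : ℕ∞ :=
  sInf {e : ℕ∞ | ∃ n : ℕ, e = n ∧ projDimLE A M n}

/-- `N` has injective dimension at most `n`, characterized by vanishing of
`Ext^k(-, N)` for `k > n`. -/
def injDimLE (A : Type) [Ring A] (N : ModuleCat.{0} A) (n : ℕ) : Prop :=
  ∀ (M : ModuleCat.{0} A) (k : ℕ), n < k → Subsingleton (Abelian.Ext M N k)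

/-- The injective dimension of `N`, valued in `ℕ∞`. -/
def injDim (A : Type) [Ring A] (N : ModuleCat.{0} A) : ℕ∞ :=
  sInf {e : ℕ∞ | ∃ n : ℕ, e = n ∧ injDimLE A N n}

/-- The (left) global dimension of `A`: the supremum of projective dimensions of
all left `A`-modules. -/
def globalDim (A : Type) [Ring A] : ℕ∞ :=
  ⨆ M : ModuleCat.{0} A, projDim A M

/-- `N` is the (first) syzygy of `M`: `N` is isomorphic to the kernel of a
projective cover `P → M` (a surjection from a projective module with superfluous
kernel, i.e. kernel contained in `J·P`). -/
def IsSyzygy (A : Type) [Ring A] (M N : ModuleCat.{0} A) : Prop :=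
  ∃ (P : ModuleCat.{0} A) (f : P →ₗ[A] M), Module.Projective A P ∧
    Function.Surjective f ∧ LinearMap.ker f ≤ jSmul A (⊤ : Submodule A P) ∧
    Nonempty (N ≃ₗ[A] LinearMap.ker f)

/-- `N` is the `n`-th syzygy `Ω^n M` of `M` in its minimal projective resolution. -/
def IsNthSyzygy (A : Type) [Ring A] : ℕ → ModuleCat.{0} A → ModuleCat.{0} A → Prop
  | 0, M, N => Nonempty (M ≃ₗ[A] N)
  | n + 1, M, N => ∃ K : ModuleCat.{0} A, IsNthSyzygy A n M K ∧ IsSyzygy A K N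

/-- `S` is (isomorphic to) a direct summand of the module `W`. -/
def IsDirectSummandOf (A : Type) [Ring A] (S W : ModuleCat.{0} A) : Prop :=
  ∃ U V : Submodule A W, IsCompl U V ∧ Nonempty (S ≃ₗ[A] U)

/-- The submodule `X` is a direct summand of the submodule `W` (inside a common
ambient module). -/
def IsSummandIn (A : Type) [Ring A] {P : Type} [AddCommGroup P] [Module A P]
    (X W : Submodule A P) : Prop :=
  X ≤ W ∧ ∃ C ≤ W, X ⊓ C = ⊥ ∧ X ⊔ C = W

/-- The module `N` (a submodule of an ambient module) has no simple direct summand. -/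
def NoSimpleSummand (A : Type) [Ring A] {P : Type} [AddCommGroup P] [Module A P]
    (N : Submodule A P) : Prop :=
  ¬ ∃ S : Submodule A P, IsSimpleModule A S ∧ IsSummandIn A S N

/-- The order relation on simple modules: `S ⪯ T` iff `S` is a direct summand of
some syzygy `Ω^m T`. -/
def Preceq (A : Type) [Ring A] (S T : ModuleCat.{0} A) : Prop :=
  ∃ (m : ℕ) (W : ModuleCat.{0} A), IsNthSyzygy A m T W ∧ IsDirectSummandOf A S W

/-- `Ext_A^n(S, S) = 0` for every simple `A`-module `S` and every `n ≥ m`. -/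
def ExtSelfVanishes (A : Type) [Ring A] (m : ℕ) : Prop :=
  ∀ S : ModuleCat.{0} A, IsSimpleModule A S →
    ∀ n : ℕ, m ≤ n → Subsingleton (Abelian.Ext S S n)

/-- The Yoneda ring `E = ⊕ₙ Ext^n(A/J, A/J)` is generated in finite degrees:
there is `s` such that every homogeneous element of degree `n > s` is a sum of
Yoneda products of homogeneous elements of positive degrees `< n`. -/
def YonedaGeneratedInFiniteDegrees (A : Type) [Ring A] : Prop :=
  ∃ s : ℕ, ∀ n : ℕ, s < n → ∀ e : Abelian.Ext (AmodJ A) (AmodJ A) n,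
    e ∈ AddSubgroup.closure {x : Abelian.Ext (AmodJ A) (AmodJ A) n |
      ∃ (i j : ℕ) (h : i + j = n) (_ : 0 < i) (_ : 0 < j)
        (a : Abelian.Ext (AmodJ A) (AmodJ A) i)
        (b : Abelian.Ext (AmodJ A) (AmodJ A) j), x = a.comp b h}

/-- The data of the canonical sequence `(M₀ = S, M₁, M₂, ...)` associated to a
simple module `S` over a ring with `J³ = 0`: for each `n`, `P n` is a projective
cover of `M n`, and its kernel (the syzygy `Ω M_n`) decomposes as
`M_{n+1} ⊕ Y_{n+1}`, where `Y_{n+1}` is a direct summand of `J²·P n` and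
`M_{n+1} ∩ J²·P n = J·M_{n+1}`. -/
structure AssocSeqData (A : Type) [Ring A] (S : ModuleCat.{0} A) where
  M : ℕ → ModuleCat.{0} A
  iso0 : Nonempty (M 0 ≃ₗ[A] S)
  P : ℕ → ModuleCat.{0} A
  proj : ∀ n, Module.Projective A (P n)
  π : ∀ n, P n →ₗ[A] M n
  surj : ∀ n, Function.Surjective (π n)
  cover : ∀ n, LinearMap.ker (π n) ≤ jSmul A (⊤ : Submodule A (P n))
  Msub : ∀ n, Submodule A (P n)
  Ysub : ∀ n, Submodule A (P n)
  isoM : ∀ n, Nonempty (M (n + 1) ≃ₗ[A] Msub n)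
  indep : ∀ n, Msub n ⊓ Ysub n = ⊥
  sup_eq : ∀ n, Msub n ⊔ Ysub n = LinearMap.ker (π n)
  Y_summand : ∀ n, IsSummandIn A (Ysub n) (jSmul A (jSmul A (⊤ : Submodule A (P n))))
  M_cap : ∀ n, Msub n ⊓ jSmul A (jSmul A (⊤ : Submodule A (P n))) = jSmul A (Msub n)

/-- The iterated Yoneda product `eₙ · ... · e₂ · e₁ · 1` of classes
`eᵢ ∈ Ext^1(S_{i-1}, S_i)`. -/
def extChain (A : Type) [Ring A] (S : ℕ → ModuleCat.{0} A)
    (e : ∀ i : ℕ, Abelian.Ext (S i) (S (i + 1)) 1) :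
    ∀ n : ℕ, Abelian.Ext (S 0) (S n) n
  | 0 => Abelian.Ext.mk₀ (𝟙 (S 0))
  | n + 1 => (extChain A S e n).comp (e n) rfl

/-- The iterated Yoneda product `eₙ · ... · e₁ · f` where `f ∈ Ext^0(S, A/J)` and
`eᵢ ∈ Ext^1(A/J, A/J)`. -/
def extChainFrom (A : Type) [Ring A] {S : ModuleCat.{0} A}
    (f : Abelian.Ext S (AmodJ A) 0)
    (e : ℕ → Abelian.Ext (AmodJ A) (AmodJ A) 1) :
    ∀ n : ℕ, Abelian.Ext S (AmodJ A) n
  | 0 => f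
  | n + 1 => (extChainFrom A f e n).comp (e n) rfl

universe u v w

section SemisimpleQuotient

variable {A : Type*} [Ring A] {J : Ideal A} {M : Type*} [AddCommGroup M] [Module A M]

lemma isSemisimpleModule_of_smul_top_eq_bot [IsSemisimpleModule A (A ⧸ J)]
    (h : J • (⊤ : Submodule A M) = ⊥) : IsSemisimpleModule A M := by
  have hle (m : M) : J ≤ LinearMap.ker (LinearMap.toSpanSingleton A M m) := fun a ha ↦ by
    have : a • m ∈ J • (⊤ : Submodule A M) := Submodule.smul_mem_smul ha trivial
    simpa [h] using this
  refine .of_surjective (Finsupp.lsum ℕ fun m : M ↦ J.liftQ _ (hle m)) fun m ↦ ?_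
  exact ⟨Finsupp.single m (Submodule.Quotient.mk 1), by simp⟩

lemma smul_top_submodule_eq_bot {N : Submodule A M} (h : J • N = ⊥) :
    J • (⊤ : Submodule A N) = ⊥ := by
  apply Submodule.map_injective_of_injective N.subtype_injective
  rw [Submodule.map_smul'', Submodule.map_top, Submodule.range_subtype, h, Submodule.map_bot]

lemma smul_top_quotient_eq_bot {N : Submodule A M} (h : J • ⊤ ≤ N) :
    J • (⊤ : Submodule A (M ⧸ N)) = ⊥ := by
  rw [← N.range_mkQ, ← Submodule.map_top, ← Submodule.map_smul'', eq_bot_iff,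
    Submodule.map_le_iff_le_comap]
  simpa using h

lemma smul_top_pi_eq_bot (h : J • (⊤ : Submodule A M) = ⊥) (I : Type*) :
    J • (⊤ : Submodule A (I → M)) = ⊥ := by
  refine eq_bot_iff.2 (Submodule.smul_le.2 fun a ha x _ ↦ ?_)
  refine (Submodule.mem_bot A).2 (funext fun i ↦ ?_)
  have : a • x i ∈ J • (⊤ : Submodule A M) := Submodule.smul_mem_smul ha trivial
  simpa [h] using this

lemma smul_smul_smul_eq_bot (h3 : J * J * J = ⊥) (N : Submodule A M) : J • J • J • N = ⊥ := by
  rw [← Submodule.mul_smul, ← Submodule.mul_smul, h3, Submodule.bot_smul]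

lemma eq_bot_of_le_smul (h3 : J * J * J = ⊥) {N : Submodule A M} (h : N ≤ J • N) : N = ⊥ := by
  rw [eq_bot_iff, ← smul_smul_smul_eq_bot h3 N]
  exact h.trans (smul_mono_right J (h.trans (smul_mono_right J h)))

lemma IsSimpleModule.smul_top_eq_bot [IsSimpleModule A M] (h3 : J * J * J = ⊥) :
    J • (⊤ : Submodule A M) = ⊥ :=
  (eq_bot_or_eq_top _).resolve_right fun h ↦
    top_ne_bot (eq_bot_of_le_smul h3 h.ge)

lemma eq_top_of_sup_smul_top (h3 : J * J * J = ⊥) {N : Submodule A M} (h : N ⊔ J • ⊤ = ⊤) :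
    N = ⊤ := by
  have hle : (⊤ : Submodule A (M ⧸ N)) ≤ J • ⊤ := by
    rw [← N.range_mkQ, ← Submodule.map_top, ← Submodule.map_smul'']
    nth_rw 1 [← h]
    rw [Submodule.map_sup, N.mkQ_map_self, bot_sup_eq]
  exact Submodule.Quotient.subsingleton_iff.1
    ((Submodule.subsingleton_iff A).1 (subsingleton_of_bot_eq_top (eq_bot_of_le_smul h3 hle).symm))

lemma isIdempotentElem_of_pow_three_eq_zero {R : Type*} [Ring R] {x : R}
    (h : (x ^ 2 - x) ^ 3 = 0) : IsIdempotentElem (1 - (1 - x ^ 3) ^ 3) := by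
  let p : Polynomial ℤ := .X
  have key : (1 - (1 - p ^ 3) ^ 3) * (1 - (1 - p ^ 3) ^ 3) - (1 - (1 - p ^ 3) ^ 3) =
      (p ^ 2 - p) ^ 3 * ((1 + p + p ^ 2) ^ 3 * (p ^ 6 - 3 * p ^ 3 + 3)) := by ring
  have := congrArg (Polynomial.aeval x) key
  simp only [map_sub, map_mul, map_pow, map_one, p, Polynomial.aeval_X, h, zero_mul] at this
  exact sub_eq_zero.1 this

/-- Every module over a ring with `A / J` semisimple and `J ^ 3 = 0` has a projective cover. -/
lemma exists_projective_cover {A : Type u} [Ring A] {J : Ideal A} [J.IsTwoSided]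
    (h3 : J * J * J = ⊥) [IsSemisimpleModule A (A ⧸ J)] (M : Type u) [AddCommGroup M] [Module A M] :
    ∃ (P : ModuleCat.{u} A) (f : P →ₗ[A] M), Module.Projective A P ∧ Function.Surjective f ∧
      LinearMap.ker f ≤ J • ⊤ := by
  let F := M →₀ A
  let p : F →ₗ[A] M := Finsupp.linearCombination A id
  have hp : Function.Surjective p := Finsupp.linearCombination_id_surjective A M
  let JF : Submodule A F := J • ⊤
  let q : F →ₗ[A] M ⧸ (J • ⊤ : Submodule A M) := (J • ⊤ : Submodule A M).mkQ ∘ₗ p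
  have hq : Function.Surjective q := (Submodule.mkQ_surjective _).comp hp
  have hJF : JF ≤ LinearMap.ker q := by
    rw [LinearMap.ker_comp, Submodule.ker_mkQ, ← Submodule.map_le_iff_le_comap,
      Submodule.map_smul'']
    exact smul_mono_right J le_top
  have hss : IsSemisimpleModule A (F ⧸ JF) :=
    isSemisimpleModule_of_smul_top_eq_bot (smul_top_quotient_eq_bot le_rfl)
  obtain ⟨s, hs⟩ := IsSemisimpleModule.lifting_property (JF.liftQ q hJF)
    (fun x ↦ (hq x).imp' JF.mkQ fun a ha ↦ by simpa using ha) LinearMap.id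
  have hs (x) : JF.liftQ q hJF (s x) = x := LinearMap.congr_fun hs x
  obtain ⟨e₀, he₀⟩ := Module.projective_lifting_property JF.mkQ (s ∘ₗ q) JF.mkQ_surjective
  have he₀ (x) : JF.mkQ (e₀ x) = s (q x) := LinearMap.congr_fun he₀ x
  have hqe₀ (x) : q (e₀ x) = q x := by
    rw [← hs (q x), ← he₀]; simp
  let e : Module.End A F := 1 - (1 - e₀ ^ 3) ^ 3
  have hnil : (e₀ ^ 2 - e₀) ^ 3 = 0 := by
    have hr : Submodule.map (e₀ ^ 2 - e₀) ⊤ ≤ J • (⊤ : Submodule A F) := by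
      rintro _ ⟨x, -, rfl⟩
      change _ ∈ JF
      rw [← JF.ker_mkQ, LinearMap.mem_ker]
      simp [pow_two, he₀, hqe₀, -Submodule.mkQ_apply]
    have h1 := Submodule.map_mono (f := e₀ ^ 2 - e₀) hr
    have h2 := Submodule.map_mono (f := e₀ ^ 2 - e₀) h1
    rw [Submodule.map_smul''] at h1
    rw [Submodule.map_smul'', Submodule.map_smul''] at h2
    replace h2 := h2.trans (smul_mono_right J (h1.trans (smul_mono_right J hr)))
    rw [smul_smul_smul_eq_bot h3] at h2
    refine LinearMap.ext fun x ↦ ?_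
    rw [pow_three]
    exact h2 ⟨_, ⟨_, ⟨x, trivial, rfl⟩, rfl⟩, rfl⟩
  have he : IsIdempotentElem e :=
    isIdempotentElem_of_pow_three_eq_zero (x := e₀) hnil
  have hee (x) : e (e x) = e x := LinearMap.congr_fun he x
  have hse (x) : JF.mkQ (e x) = s (q x) := by
    simp [e, pow_three, he₀, hqe₀, -Submodule.mkQ_apply]
  have hqe (x) : q (e x) = q x := by
    rw [← hs (q x), ← hse]; simp
  refine ⟨ModuleCat.of A (LinearMap.range e), p ∘ₗ (LinearMap.range e).subtype, ?_, ?_, ?_⟩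
  · refine Module.Projective.of_split (LinearMap.range e).subtype e.rangeRestrict ?_
    ext ⟨_, x, rfl⟩
    simp [hee]
  · rw [← LinearMap.range_eq_top]
    refine eq_top_of_sup_smul_top h3 (eq_top_iff.2 fun m _ ↦ ?_)
    obtain ⟨x, rfl⟩ := hp m
    rw [Submodule.mem_sup]
    refine ⟨p (e x), ⟨⟨e x, x, rfl⟩, rfl⟩, p x - p (e x), ?_, by simp⟩
    rw [← Submodule.ker_mkQ (J • ⊤ : Submodule A M), LinearMap.mem_ker, map_sub, sub_eq_zero]
    exact (hqe x).symm
  · rintro ⟨_, x, rfl⟩ hx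
    have hx : p (e x) = 0 := hx
    have hmem : e x ∈ JF := by
      rw [← JF.ker_mkQ, LinearMap.mem_ker, hse, ← hqe]
      simp [q, hx]
    have := Submodule.mem_map_of_mem (f := e.rangeRestrict) hmem
    rw [Submodule.map_smul''] at this
    have hmono : J • Submodule.map e.rangeRestrict ⊤ ≤ J • ⊤ := smul_mono_right J le_top
    convert hmono this using 1
    exact Subtype.ext (hee x).symm

lemma exists_simple_retract [IsSemisimpleModule A (A ⧸ J)] {L : Submodule A M} (hL : J • L = ⊥)
    (h : ¬ L ≤ J • ⊤) :
    ∃ (T : Submodule A M) (r : M →ₗ[A] T), IsSimpleModule A T ∧ ∀ x : T, r x = x := by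
  have hssL : IsSemisimpleModule A L :=
    isSemisimpleModule_of_smul_top_eq_bot (smul_top_submodule_eq_bot hL)
  have hssM : IsSemisimpleModule A (M ⧸ (J • ⊤ : Submodule A M)) :=
    isSemisimpleModule_of_smul_top_eq_bot (smul_top_quotient_eq_bot le_rfl)
  obtain ⟨T, hT, hTJ⟩ : ∃ T : Submodule A M, IsSimpleModule A T ∧ ¬ T ≤ J • ⊤ := by
    by_contra! hall
    have hle : sSup {T : Submodule A L | IsSimpleModule A T} ≤ _ := sSup_le fun T hT ↦
      have : IsSimpleModule A T := hT
      Submodule.map_le_iff_le_comap.1 (hall (T.map L.subtype)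
        (.congr (T.equivMapOfInjective _ L.subtype_injective).symm))
    rw [IsSemisimpleModule.sSup_simples_eq_top, ← Submodule.map_le_iff_le_comap,
      Submodule.map_top, Submodule.range_subtype] at hle
    exact h hle
  have hne : (J • ⊤ : Submodule A M).mkQ ∘ₗ T.subtype ≠ 0 := fun h0 ↦ hTJ fun x hx ↦ by
    simpa using LinearMap.congr_fun h0 ⟨x, hx⟩
  obtain ⟨r, hr⟩ := IsSemisimpleModule.extension_property _
    (LinearMap.injective_of_ne_zero hne) LinearMap.id
  exact ⟨T, r ∘ₗ (J • ⊤ : Submodule A M).mkQ, hT, LinearMap.congr_fun hr⟩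

lemma exists_extension_mkQ [IsSemisimpleModule A (A ⧸ J)] {K : Submodule A M} (hK : K ≤ J • ⊤)
    (h : (J • J • ⊤ : Submodule A M).comap K.subtype ≤ J • ⊤) :
    ∃ g : (J • ⊤ : Submodule A M) →ₗ[A] K ⧸ (J • ⊤ : Submodule A K),
      g ∘ₗ Submodule.inclusion hK = (J • ⊤ : Submodule A K).mkQ := by
  let JM : Submodule A M := J • ⊤
  let JJM : Submodule A JM := J • ⊤
  have hss : IsSemisimpleModule A (JM ⧸ JJM) :=
    isSemisimpleModule_of_smul_top_eq_bot (smul_top_quotient_eq_bot le_rfl)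
  have hle : J • ⊤ ≤ JJM.comap (Submodule.inclusion hK) := by
    rw [← Submodule.map_le_iff_le_comap, Submodule.map_smul'']
    exact smul_mono_right J le_top
  have hinj : Function.Injective (Submodule.mapQ _ _ _ hle) := by
    rw [← LinearMap.ker_eq_bot, eq_bot_iff]
    intro x hx
    obtain ⟨x, rfl⟩ := Submodule.mkQ_surjective _ x
    have hx : Submodule.inclusion hK x ∈ JJM := by simpa using hx
    have hx := Submodule.mem_map_of_mem (f := JM.subtype) hx
    rw [Submodule.map_smul'', Submodule.map_top, Submodule.range_subtype] at hx
    simpa using h hx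
  obtain ⟨g, hg⟩ := IsSemisimpleModule.extension_property _ hinj LinearMap.id
  exact ⟨g ∘ₗ JJM.mkQ, LinearMap.ext fun x ↦ LinearMap.congr_fun hg (Submodule.mkQ _ x)⟩

/-- If `A / J` is semisimple, there are finitely many simple modules `T t` such that the identity
of any module killed by `J` is a sum of maps factoring through direct sums of copies of the
`T t`. -/
lemma exists_simple_family (A : Type u) [Ring A] (J : Ideal A) [IsSemisimpleModule A (A ⧸ J)] :
    ∃ (n : ℕ) (T : Fin n → ModuleCat.{u} A), (∀ t, IsSimpleModule A (T t)) ∧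
      ∀ (V : Type u) [AddCommGroup V] [Module A V], J • (⊤ : Submodule A V) = ⊥ →
        ∃ (I : Type u) (α : ∀ t, V →ₗ[A] I →₀ T t) (β : ∀ t, (I →₀ T t) →ₗ[A] V),
          ∑ t, β t ∘ₗ α t = LinearMap.id := by
  classical
  obtain ⟨n, T, e, hT⟩ := IsSemisimpleModule.exists_linearEquiv_fin_dfinsupp A (A ⧸ J)
  refine ⟨n, fun t ↦ ModuleCat.of A (T t), hT, fun V _ _ hV ↦ ?_⟩
  have hss : IsSemisimpleModule A V := isSemisimpleModule_of_smul_top_eq_bot hV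
  have hle (m : V) : J ≤ LinearMap.ker (LinearMap.toSpanSingleton A V m) := fun a ha ↦ by
    have : a • m ∈ J • (⊤ : Submodule A V) := Submodule.smul_mem_smul ha trivial
    simpa [hV] using this
  let σ : (V →₀ A ⧸ J) →ₗ[A] V := Finsupp.lsum ℕ fun m : V ↦ J.liftQ _ (hle m)
  obtain ⟨s, hs⟩ := IsSemisimpleModule.lifting_property σ
    (fun m ↦ ⟨Finsupp.single m (Submodule.Quotient.mk 1), by simp [σ]⟩) LinearMap.id
  let i (t) : T t →ₗ[A] A ⧸ J :=
    e.symm.toLinearMap ∘ₗ DFinsupp.lsingle (M := fun t ↦ T t) t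
  let p (t) : A ⧸ J →ₗ[A] T t :=
    DFinsupp.lapply (M := fun t ↦ T t) t ∘ₗ e.toLinearMap
  have hip (x) : ∑ t, i t (p t x) = x := by
    apply e.injective
    ext t
    simp [i, p, DFinsupp.single_apply]
  refine ⟨V, fun t ↦ Finsupp.mapRange.linearMap (p t) ∘ₗ s,
    fun t ↦ σ ∘ₗ Finsupp.mapRange.linearMap (i t), LinearMap.ext fun x ↦ ?_⟩
  have : ∑ t, Finsupp.mapRange.linearMap (i t) (Finsupp.mapRange.linearMap (p t) (s x)) = s x := by
    ext v
    simp [Finsupp.finsetSum_apply, hip]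
  simp only [LinearMap.sum_apply, LinearMap.comp_apply, ← map_sum, this]
  exact LinearMap.congr_fun hs x

end SemisimpleQuotient
section Ext

open Abelian

variable {C : Type u} [Category.{v} C] [Abelian C] [HasExt.{w} C]

lemma extClass_comp_injective {S : ShortComplex C} (hS : S.ShortExact) {Y : C}
    [Projective S.X₂] (h : ∀ φ : S.X₂ ⟶ Y, S.f ≫ φ = 0) {n m : ℕ} (hm : 1 + n = m)
    {x : Ext S.X₁ Y n} (hx : hS.extClass.comp x hm = 0) : x = 0 := by
  obtain ⟨y, rfl⟩ := Ext.contravariant_sequence_exact₁ hS Y x hm hx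
  obtain _ | n := n
  · obtain ⟨φ, rfl⟩ := Ext.mk₀_bijective _ _ |>.2 y
    rw [Ext.mk₀_comp_mk₀, h, Ext.mk₀_zero]
  · rw [Ext.eq_zero_of_projective y, Ext.comp_zero]

lemma exists_extClass_comp_eq {S : ShortComplex C} (hS : S.ShortExact) {Y : C}
    [Projective S.X₂] {n m : ℕ} (hm : 1 + n = m) (x : Ext S.X₃ Y m) :
    ∃ y, hS.extClass.comp y hm = x := by
  obtain rfl : m = n + 1 := by lia
  exact Ext.contravariant_sequence_exact₃ hS Y x (Ext.eq_zero_of_projective _) hm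

lemma subsingleton_ext_one_iff {S : ShortComplex C} (hS : S.ShortExact) (Y : C)
    [Projective S.X₂] :
    Subsingleton (Ext S.X₃ Y 1) ↔ ∀ φ : S.X₁ ⟶ Y, ∃ ψ : S.X₂ ⟶ Y, S.f ≫ ψ = φ := by
  refine ⟨fun h φ ↦ ?_, fun h ↦ subsingleton_of_forall_eq 0 fun x ↦ ?_⟩
  · obtain ⟨y, hy⟩ := Ext.contravariant_sequence_exact₁ hS Y (Ext.mk₀ φ) rfl
      (Subsingleton.elim _ _)
    obtain ⟨ψ, rfl⟩ := Ext.mk₀_bijective _ _ |>.2 y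
    exact ⟨ψ, Ext.mk₀_bijective _ _ |>.1 (by rw [← hy, Ext.mk₀_comp_mk₀])⟩
  · obtain ⟨y, rfl⟩ := exists_extClass_comp_eq hS (add_zero 1) x
    obtain ⟨φ, rfl⟩ := Ext.mk₀_bijective _ _ |>.2 y
    obtain ⟨ψ, rfl⟩ := h φ
    rw [← Ext.mk₀_comp_mk₀, hS.extClass_comp_assoc]

lemma subsingleton_ext_succ_iff {S : ShortComplex C} (hS : S.ShortExact) (Y : C)
    [Projective S.X₂] (n : ℕ) :
    Subsingleton (Ext S.X₃ Y (n + 2)) ↔ Subsingleton (Ext S.X₁ Y (n + 1)) := by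
  have hn : 1 + (n + 1) = n + 2 := by lia
  refine ⟨fun h ↦ subsingleton_of_forall_eq 0 fun x ↦ ?_,
    fun h ↦ subsingleton_of_forall_eq 0 fun x ↦ ?_⟩
  · obtain ⟨y, rfl⟩ := Ext.contravariant_sequence_exact₁ hS Y x hn (Subsingleton.elim _ _)
    rw [Ext.eq_zero_of_projective y, Ext.comp_zero]
  · obtain ⟨y, rfl⟩ := exists_extClass_comp_eq hS hn x
    rw [Subsingleton.elim y 0, Ext.comp_zero]

/-- The exact sequence obtained by applying `I →₀ -` to `0 → ker f → P → M → 0`. -/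
def finsuppShortComplexKer {A : Type u} [Ring A] (I : Type u) {P M : ModuleCat.{u} A}
    (f : P →ₗ[A] M) : ShortComplex (ModuleCat.{u} A) where
  X₁ := ModuleCat.of A (I →₀ LinearMap.ker f)
  X₂ := ModuleCat.of A (I →₀ P)
  X₃ := ModuleCat.of A (I →₀ M)
  f := ModuleCat.ofHom (Finsupp.mapRange.linearMap (LinearMap.ker f).subtype)
  g := ModuleCat.ofHom (Finsupp.mapRange.linearMap f)
  zero := by ext; simp

lemma shortExact_finsuppShortComplexKer {A : Type u} [Ring A] (I : Type u) {P M : ModuleCat.{u} A}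
    {f : P →ₗ[A] M} (hf : Function.Surjective f) : (finsuppShortComplexKer I f).ShortExact := by
  refine ModuleCat.shortComplex_shortExact _ (LinearMap.exact_iff.2 ?_)
    (Finsupp.mapRange_injective _ rfl (Submodule.subtype_injective _))
    (Finsupp.mapRange_surjective _ (map_zero f) hf)
  change LinearMap.ker (Finsupp.mapRange.linearMap f) =
    LinearMap.range (Finsupp.mapRange.linearMap (LinearMap.ker f).subtype)
  rw [Finsupp.ker_mapRange, Finsupp.range_mapRange_linearMap _ (Submodule.ker_subtype _),
    Submodule.range_subtype]

lemma subsingleton_ext_finsupp_pi {A : Type u} [Ring A] [HasExt.{w} (ModuleCat.{u} A)]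
    (I I' : Type u) {X Y : ModuleCat.{u} A} {n : ℕ} (h : Subsingleton (Ext X Y (n + 1))) :
    Subsingleton (Ext (ModuleCat.of A (I →₀ X)) (ModuleCat.of A (I' → Y)) (n + 1)) := by
  let f (X : ModuleCat.{u} A) : ModuleCat.of A (X →₀ A) →ₗ[A] X := Finsupp.linearCombination A id
  have hf (X) : Function.Surjective (f X) := Finsupp.linearCombination_id_surjective A X
  have hS (X) := (f X).shortExact_shortComplexKer (hf X)
  have hS' (X) := shortExact_finsuppShortComplexKer I (hf X)
  have hP (X) : Projective (f X).shortComplexKer.X₂ :=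
    (IsProjective.iff_projective (R := A) (X →₀ A)).1 inferInstance
  have hP' (X) : Projective (finsuppShortComplexKer I (f X)).X₂ :=
    (IsProjective.iff_projective (R := A) (I →₀ X →₀ A)).1 inferInstance
  induction n generalizing X with
  | zero =>
    refine (subsingleton_ext_one_iff (hS' X) _).2 fun φ ↦ ?_
    have key (i i') := (subsingleton_ext_one_iff (hS X) Y).1 h
      (ModuleCat.ofHom (LinearMap.proj i' ∘ₗ φ.hom ∘ₗ Finsupp.lsingle i))
    choose ψ hψ using key
    refine ⟨ModuleCat.ofHom (LinearMap.pi fun i' ↦ Finsupp.lsum ℕ fun i ↦ (ψ i i').hom), ?_⟩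
    refine ModuleCat.hom_ext (Finsupp.lhom_ext fun i x ↦ funext fun i' ↦ ?_)
    have := LinearMap.congr_fun (congrArg ModuleCat.Hom.hom (hψ i i')) x
    simpa [finsuppShortComplexKer] using this
  | succ n ih =>
    rw [subsingleton_ext_succ_iff (hS X)] at h
    exact (subsingleton_ext_succ_iff (hS' X) _ _).2 (ih h)

end Ext

section Chains

open Abelian

variable {A : Type u} [Ring A] [HasExt.{w} (ModuleCat.{u} A)] {J : Ideal A}

lemma subsingleton_ext_finsupp_finsupp [IsSemisimpleModule A (A ⧸ J)] (I I' : Type u)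
    {T : ModuleCat.{u} A} (hT : J • (⊤ : Submodule A T) = ⊥) {n : ℕ}
    (h : Subsingleton (Ext T T (n + 1))) :
    Subsingleton (Ext (ModuleCat.of A (I →₀ T)) (ModuleCat.of A (I' →₀ T)) (n + 1)) := by
  have hss : IsSemisimpleModule A (I' → T) :=
    isSemisimpleModule_of_smul_top_eq_bot (smul_top_pi_eq_bot hT I')
  let c : (I' →₀ T) →ₗ[A] I' → T := Finsupp.lcoeFun
  have hc : Function.Injective c := DFunLike.coe_injective
  obtain ⟨r, hr⟩ := IsSemisimpleModule.extension_property c hc LinearMap.id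
  have := subsingleton_ext_finsupp_pi I I' h
  refine subsingleton_of_forall_eq 0 fun x ↦ ?_
  have hcr : ModuleCat.ofHom c ≫ ModuleCat.ofHom r = 𝟙 (ModuleCat.of A (I' →₀ T)) := by
    rw [← ModuleCat.ofHom_comp, hr, ModuleCat.ofHom_id]
  rw [← x.comp_mk₀_id, ← hcr, ← Ext.mk₀_comp_mk₀,
    ← Ext.comp_assoc_of_third_deg_zero x (Ext.mk₀ (ModuleCat.ofHom c)) _ (add_zero _),
    Subsingleton.elim (x.comp (Ext.mk₀ (ModuleCat.ofHom c)) (add_zero _)) 0, Ext.zero_comp]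

/-- A class of degree `n` is a Yoneda chain if it is a product of classes of degree one passing
through modules killed by `J`, followed by a morphism. -/
def IsYonedaChain (J : Ideal A) {Y : ModuleCat.{u} A} :
    ∀ (n : ℕ) {X : ModuleCat.{u} A}, Ext X Y n → Prop
  | 0, _, _ => True
  | n + 1, X, z => ∃ (X' : ModuleCat.{u} A) (e : Ext X X' 1) (z' : Ext X' Y n),
      J • (⊤ : Submodule A X') = ⊥ ∧ IsYonedaChain J n z' ∧ e.comp z' (add_comm 1 n) = z

lemma comp_eq_zero_of_isYonedaChain {N : ℕ} {T : Fin N → ModuleCat.{u} A}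
    (hT : ∀ (V : Type u) [AddCommGroup V] [Module A V], J • (⊤ : Submodule A V) = ⊥ →
      ∃ (I : Type u) (α : ∀ t, V →ₗ[A] I →₀ T t) (β : ∀ t, (I →₀ T t) →ₗ[A] V),
        ∑ t, β t ∘ₗ α t = LinearMap.id) {m : ℕ}
    (hm : ∀ t (I I' : Type u) (k : ℕ), m ≤ k →
      Subsingleton (Ext (ModuleCat.of A (I →₀ T t)) (ModuleCat.of A (I' →₀ T t)) k))
    {Y : ModuleCat.{u} A} (j : ℕ) {n : ℕ} (U : Finset (Fin N)) (hn : Uᶜ.card * m + j ≤ n)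
    {V : ModuleCat.{u} A} (hV : J • (⊤ : Submodule A V) = ⊥) {z : Ext V Y n}
    (hz : IsYonedaChain J n z) {X : ModuleCat.{u} A} {a : ℕ} (y : Ext X V a)
    (hy : ∀ t ∈ U, ∀ (I : Type u) (k : ℕ), j ≤ k →
      ∀ (w : Ext V (ModuleCat.of A (I →₀ T t)) k) (l : ℕ) (h : a + k = l), y.comp w h = 0)
    {l : ℕ} (hl : a + n = l) :
    y.comp z hl = 0 := by
  induction hr : Uᶜ.card using Nat.strong_induction_on generalizing j n U V X a with
  | _ r ihr =>
  induction j generalizing n V a with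
  | zero =>
    obtain ⟨I, α, β, hαβ⟩ := hT V hV
    have hid : ∑ t, ModuleCat.ofHom (α t) ≫ ModuleCat.ofHom (β t) = 𝟙 V := by
      ext x
      simpa using LinearMap.congr_fun hαβ x
    have hsum : y = ∑ t, y.comp (Ext.mk₀ (ModuleCat.ofHom (α t) ≫ ModuleCat.ofHom (β t)))
        (add_zero a) := by
      conv_lhs => rw [← y.comp_mk₀_id, ← hid, Ext.mk₀_sum, Ext.comp_sum]
    rw [hsum, Ext.sum_comp]
    refine Finset.sum_eq_zero fun t _ ↦ ?_
    by_cases ht : t ∈ U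
    · have h0 := hy t ht I 0 le_rfl (Ext.mk₀ (ModuleCat.ofHom (α t))) a (add_zero a)
      rw [← Ext.mk₀_comp_mk₀, ← Ext.comp_assoc_of_third_deg_zero y _ _ (add_zero _), h0,
        Ext.zero_comp, Ext.zero_comp]
    · have hcard : (insert t U)ᶜ.card + 1 = Uᶜ.card := by
        rw [Finset.compl_insert]
        exact Finset.card_erase_add_one (by simpa using ht)
      refine ihr (insert t U)ᶜ.card (by lia) m (insert t U) ?_ hV hz _ ?_ hl rfl
      · rw [← hcard, Nat.add_mul] at hn
        lia
      · intro s hs I' k hk w l h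
        rw [Ext.comp_assoc_of_second_deg_zero]
        obtain rfl | hs := Finset.mem_insert.1 hs
        · have := hm s I I' k hk
          rw [← Ext.mk₀_comp_mk₀, Ext.comp_assoc (Ext.mk₀ _) (Ext.mk₀ _) w (add_zero 0)
            (zero_add k) (by lia), Subsingleton.elim ((Ext.mk₀ _).comp w _) 0, Ext.comp_zero,
            Ext.comp_zero]
        · exact hy s hs I' k (by lia) _ _ _
  | succ j ihj =>
    obtain _ | n := n
    · lia
    obtain ⟨X', e, z', hX', hz', rfl⟩ := hz
    rw [← Ext.comp_assoc y e z' rfl (add_comm 1 n) (by lia)]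
    refine ihj (by lia) hX' hz' _ (fun t ht I k hk w l h ↦ ?_) (by lia)
    rw [Ext.comp_assoc y e w rfl rfl (by lia)]
    exact hy t ht I (1 + k) (by lia) _ _ _

lemma IsYonedaChain.eq_zero {N : ℕ} {T : Fin N → ModuleCat.{u} A}
    (hT : ∀ (V : Type u) [AddCommGroup V] [Module A V], J • (⊤ : Submodule A V) = ⊥ →
      ∃ (I : Type u) (α : ∀ t, V →ₗ[A] I →₀ T t) (β : ∀ t, (I →₀ T t) →ₗ[A] V),
        ∑ t, β t ∘ₗ α t = LinearMap.id) {m : ℕ}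
    (hm : ∀ t (I I' : Type u) (k : ℕ), m ≤ k →
      Subsingleton (Ext (ModuleCat.of A (I →₀ T t)) (ModuleCat.of A (I' →₀ T t)) k))
    {V Y : ModuleCat.{u} A} (hV : J • (⊤ : Submodule A V) = ⊥) {z : Ext V Y (N * m)}
    (hz : IsYonedaChain J (N * m) z) : z = 0 := by
  rw [← z.mk₀_id_comp]
  exact comp_eq_zero_of_isYonedaChain hT hm 0 ∅ (by simp) hV hz _ (by simp) _

end Chains

/-- A choice of a projective cover of every `A`-module, where superfluous kernels are expressed
through the ideal `J`. -/
structure ProjectiveCovers {A : Type u} [Ring A] (J : Ideal A) where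
  /-- The projective module covering `M`. -/
  P : ModuleCat.{u} A → ModuleCat.{u} A
  /-- The covering map. -/
  π (M : ModuleCat.{u} A) : P M →ₗ[A] M
  projective (M : ModuleCat.{u} A) : Module.Projective A (P M)
  surjective (M : ModuleCat.{u} A) : Function.Surjective (π M)
  ker_le (M : ModuleCat.{u} A) : LinearMap.ker (π M) ≤ J • ⊤

namespace ProjectiveCovers

open Abelian

variable {A : Type u} [Ring A] {J : Ideal A}

lemma nonempty [J.IsTwoSided] (h3 : J * J * J = ⊥) [IsSemisimpleModule A (A ⧸ J)] :
    Nonempty (ProjectiveCovers J) := by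
  choose P π h₁ h₂ h₃ using fun M : ModuleCat.{u} A ↦ exists_projective_cover h3 M
  exact ⟨⟨P, π, h₁, h₂, h₃⟩⟩

variable (F : ProjectiveCovers J)

/-- The kernel of the chosen projective cover of `M`. -/
abbrev syzygy (M : ModuleCat.{u} A) : ModuleCat.{u} A := ModuleCat.of A (LinearMap.ker (F.π M))

/-- The iterated syzygies of `M`. -/
def iterSyzygy : ℕ → ModuleCat.{u} A → ModuleCat.{u} A
  | 0, M => M
  | n + 1, M => iterSyzygy n (F.syzygy M)

lemma iterSyzygy_succ (n : ℕ) (M : ModuleCat.{u} A) :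
    F.iterSyzygy (n + 1) M = F.syzygy (F.iterSyzygy n M) := by
  induction n generalizing M with
  | zero => rfl
  | succ n ih => exact ih _

/-- The sequence `0 → Ω M → P → M → 0`. -/
def shortComplex (M : ModuleCat.{u} A) : ShortComplex (ModuleCat.{u} A) where
  X₁ := F.syzygy M
  X₂ := F.P M
  X₃ := M
  f := ModuleCat.ofHom (LinearMap.ker (F.π M)).subtype
  g := ModuleCat.ofHom (F.π M)
  zero := by ext x; exact x.2

lemma shortExact (M : ModuleCat.{u} A) : (F.shortComplex M).ShortExact :=
  (F.π M).shortExact_shortComplexKer (F.surjective M)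

instance (M : ModuleCat.{u} A) : Projective (F.shortComplex M).X₂ :=
  (IsProjective.iff_projective _).1 (F.projective M)

/-- The largest quotient of `M` killed by `J`. -/
def top (J : Ideal A) (M : ModuleCat.{u} A) : ModuleCat.{u} A :=
  ModuleCat.of A (M ⧸ (J • ⊤ : Submodule A M))

/-- The projection of `M` onto its largest quotient killed by `J`. -/
def toTop (J : Ideal A) (M : ModuleCat.{u} A) : M ⟶ top J M :=
  ModuleCat.ofHom (J • ⊤ : Submodule A M).mkQ

lemma smul_top_top_eq_bot [J.IsTwoSided] (M : ModuleCat.{u} A) :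
    J • (⊤ : Submodule A (top J M)) = ⊥ :=
  smul_top_quotient_eq_bot le_rfl

/-- The sequence `0 → J P → P → M / J M → 0`, where `P` is the projective cover of `M`. -/
def topShortComplex (M : ModuleCat.{u} A) : ShortComplex (ModuleCat.{u} A) where
  X₁ := ModuleCat.of A (J • ⊤ : Submodule A (F.P M))
  X₂ := F.P M
  X₃ := top J M
  f := ModuleCat.ofHom (J • ⊤ : Submodule A (F.P M)).subtype
  g := ModuleCat.ofHom ((J • ⊤ : Submodule A M).mkQ ∘ₗ F.π M)
  zero := by
    refine ModuleCat.hom_ext (LinearMap.ext fun x ↦ ?_)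
    have := Submodule.mem_map_of_mem (f := F.π M) x.2
    rw [Submodule.map_smul''] at this
    have hle : J • Submodule.map (F.π M) ⊤ ≤ J • ⊤ := smul_mono_right J le_top
    exact (Submodule.Quotient.mk_eq_zero _).2 (hle this)

lemma shortExact_topShortComplex (M : ModuleCat.{u} A) : (F.topShortComplex M).ShortExact := by
  refine ModuleCat.shortComplex_shortExact _ (LinearMap.exact_iff.2 ?_)
    (Submodule.subtype_injective _) ((Submodule.mkQ_surjective _).comp (F.surjective M))
  change LinearMap.ker ((J • ⊤ : Submodule A M).mkQ ∘ₗ F.π M) =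
    LinearMap.range (J • ⊤ : Submodule A (F.P M)).subtype
  rw [LinearMap.ker_comp, Submodule.ker_mkQ, Submodule.range_subtype,
    ← LinearMap.range_eq_top.2 (F.surjective M), ← Submodule.map_top, ← Submodule.map_smul'',
    Submodule.comap_map_eq, sup_eq_left]
  exact F.ker_le M

/-- `Ω M` has no part of `J² P` outside of its own radical. -/
def IsGood (M : ModuleCat.{u} A) : Prop :=
  (J • J • ⊤ : Submodule A (F.P M)).comap (LinearMap.ker (F.π M)).subtype ≤ J • ⊤

lemma exists_simple_retract_of_not_isGood [IsSemisimpleModule A (A ⧸ J)] [J.IsTwoSided]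
    (h3 : J * J * J = ⊥) {M : ModuleCat.{u} A} (h : ¬ F.IsGood M) :
    ∃ (T : Submodule A (F.syzygy M)) (r : F.syzygy M →ₗ[A] T),
      IsSimpleModule A T ∧ ∀ x : T, r x = x := by
  refine exists_simple_retract (J := J) ?_ h
  apply Submodule.map_injective_of_injective (Submodule.subtype_injective _)
  rw [Submodule.map_smul'', Submodule.map_bot, eq_bot_iff,
    ← smul_smul_smul_eq_bot h3 (⊤ : Submodule A (F.P M))]
  exact smul_mono_right J (Submodule.map_comap_le _ _)

lemma subsingleton_of_toTop_eq_zero (h3 : J * J * J = ⊥) {M : ModuleCat.{u} A}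
    (h : toTop J M = 0) : Subsingleton M := by
  have hle : (⊤ : Submodule A M) ≤ J • ⊤ := by
    rw [← Submodule.ker_mkQ (J • ⊤ : Submodule A M), top_le_iff, LinearMap.ker_eq_top]
    exact congrArg ModuleCat.Hom.hom h
  exact (Submodule.subsingleton_iff A).1
    (subsingleton_of_bot_eq_top (eq_bot_of_le_smul h3 hle).symm)

section Ext

variable [HasExt.{w} (ModuleCat.{u} A)]

/-- The class of the extension of `M` by `Ω M`. -/
def coverClass (M : ModuleCat.{u} A) : Ext M (F.syzygy M) 1 := (F.shortExact M).extClass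

/-- The class of the beginning of the chosen projective resolution of `M`. -/
def extClass : ∀ (n : ℕ) (M : ModuleCat.{u} A), Ext M (F.iterSyzygy n M) n
  | 0, M => Ext.mk₀ (𝟙 M)
  | n + 1, M => (F.coverClass M).comp (extClass n (F.syzygy M)) (add_comm 1 n)

lemma eq_zero_of_extClass_comp_eq_zero {Y : ModuleCat.{u} A}
    (hY : J • (⊤ : Submodule A Y) = ⊥) {n : ℕ} {M : ModuleCat.{u} A} {k l : ℕ} (h : n + k = l)
    {z : Ext (F.iterSyzygy n M) Y k} (hz : (F.extClass n M).comp z h = 0) : z = 0 := by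
  induction n generalizing M l with
  | zero =>
    obtain rfl : l = k := by lia
    rw [← z.mk₀_id_comp]
    exact hz
  | succ n ih =>
    refine ih rfl (extClass_comp_injective (F.shortExact M) (fun φ ↦ ?_)
      (show 1 + (n + k) = l by lia) ?_)
    · let ψ : F.P M →ₗ[A] Y := φ.hom
      refine ModuleCat.hom_ext (LinearMap.ext fun x ↦ ?_)
      have := Submodule.mem_map_of_mem (f := ψ) (F.ker_le M x.2)
      have hle : J • Submodule.map ψ ⊤ ≤ J • ⊤ := smul_mono_right J le_top
      rw [Submodule.map_smul''] at this
      rw [hY] at hle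
      exact hle this
    · exact (Ext.comp_assoc (F.coverClass M) (F.extClass n _) z _ _ (by lia)).symm.trans hz

lemma exists_extClass_comp_eq {Y : ModuleCat.{u} A} {n k l : ℕ} {M : ModuleCat.{u} A}
    (h : n + (k + 1) = l) (x : Ext M Y l) : ∃ y, (F.extClass n M).comp y h = x := by
  induction n generalizing M l with
  | zero =>
    obtain rfl : l = k + 1 := by lia
    exact ⟨x, x.mk₀_id_comp⟩
  | succ n ih =>
    obtain ⟨y, rfl⟩ := _root_.exists_extClass_comp_eq (F.shortExact M)
      (show 1 + (n + (k + 1)) = l by lia) x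
    obtain ⟨y, rfl⟩ := ih rfl y
    exact ⟨y, Ext.comp_assoc _ _ _ _ _ (by lia)⟩

lemma IsGood.exists_ext_top [IsSemisimpleModule A (A ⧸ J)] {F : ProjectiveCovers J}
    {M : ModuleCat.{u} A} (h : F.IsGood M) :
    ∃ e : Ext (top J M) (top J (F.syzygy M)) 1,
      (F.coverClass M).comp (Ext.mk₀ (toTop J (F.syzygy M))) (add_zero 1) =
        (Ext.mk₀ (toTop J M)).comp e (zero_add 1) := by
  obtain ⟨g, hg⟩ := exists_extension_mkQ (F.ker_le M) h
  let τ : F.syzygy M ⟶ ModuleCat.of A (J • ⊤ : Submodule A (F.P M)) :=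
    ModuleCat.ofHom (Submodule.inclusion (F.ker_le M))
  let ε : Ext (top J M) (ModuleCat.of A (J • ⊤ : Submodule A (F.P M))) 1 :=
    (F.shortExact_topShortComplex M).extClass
  have hnat : (F.coverClass M).comp (Ext.mk₀ τ) (add_zero 1) =
      (Ext.mk₀ (toTop J M)).comp ε (zero_add 1) :=
    (F.shortExact M).extClass_naturality (F.shortExact_topShortComplex M)
      { τ₁ := τ, τ₂ := 𝟙 _, τ₃ := toTop J M, comm₁₂ := rfl, comm₂₃ := rfl }
  let γ : ModuleCat.of A (J • ⊤ : Submodule A (F.P M)) ⟶ top J (F.syzygy M) := ModuleCat.ofHom g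
  have hτ : toTop J (F.syzygy M) = τ ≫ γ := ModuleCat.hom_ext hg.symm
  refine ⟨ε.comp (Ext.mk₀ γ) (add_zero 1), ?_⟩
  rw [hτ, ← Ext.mk₀_comp_mk₀, ← Ext.comp_assoc_of_third_deg_zero, hnat,
    Ext.comp_assoc_of_third_deg_zero]

lemma exists_isYonedaChain [IsSemisimpleModule A (A ⧸ J)] [J.IsTwoSided] {n : ℕ}
    {M : ModuleCat.{u} A} (h : ∀ i < n, F.IsGood (F.iterSyzygy i M)) :
    ∃ z : Ext (top J M) (top J (F.iterSyzygy n M)) n, IsYonedaChain J n z ∧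
      (F.extClass n M).comp (Ext.mk₀ (toTop J (F.iterSyzygy n M))) (add_zero n) =
        (Ext.mk₀ (toTop J M)).comp z (zero_add n) := by
  induction n generalizing M with
  | zero => exact ⟨Ext.mk₀ (𝟙 _), trivial, by simp [extClass, iterSyzygy]⟩
  | succ n ih =>
    obtain ⟨z, hz, hzq⟩ := ih (M := F.syzygy M) fun i hi ↦ h (i + 1) (by lia)
    obtain ⟨e, he⟩ := IsGood.exists_ext_top (M := M) (h 0 n.succ_pos)
    refine ⟨e.comp z (add_comm 1 n), ⟨_, e, z, smul_top_top_eq_bot _, hz, rfl⟩, ?_⟩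
    refine (Ext.comp_assoc_of_third_deg_zero (F.coverClass M) (F.extClass n (F.syzygy M))
      (Ext.mk₀ (toTop J (F.iterSyzygy n (F.syzygy M)))) (add_comm 1 n)).trans ?_
    rw [hzq, ← Ext.comp_assoc _ _ _ (add_zero 1) (zero_add n) (by lia), he,
      Ext.comp_assoc _ _ _ (zero_add 1) (add_comm 1 n) (by lia)]
    rfl

lemma exists_not_subsingleton_ext_self {S : ModuleCat.{u} A} [Nontrivial S]
    (hS : J • (⊤ : Submodule A S) = ⊥) {n : ℕ} {ι : S ⟶ F.iterSyzygy (n + 1) S}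
    {r : F.iterSyzygy (n + 1) S ⟶ S} (h : ι ≫ r = 𝟙 S) (m : ℕ) :
    ∃ l, m ≤ l ∧ ¬ Subsingleton (Ext S S l) := by
  suffices ∃ l, m ≤ l ∧ ∃ x : Ext S S l, x ≠ 0 by
    obtain ⟨l, hl, x, hx⟩ := this
    exact ⟨l, hl, fun _ ↦ hx (Subsingleton.elim _ _)⟩
  induction m with
  | zero =>
    refine ⟨0, le_rfl, Ext.mk₀ (𝟙 S), fun h0 ↦ ?_⟩
    rw [Ext.mk₀_eq_zero_iff] at h0
    obtain ⟨x, hx⟩ := exists_ne (0 : S)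
    exact hx (LinearMap.congr_fun (congrArg ModuleCat.Hom.hom h0) x)
  | succ m ih =>
    obtain ⟨l, hl, x, hx⟩ := ih
    refine ⟨n + 1 + l, by lia, (F.extClass (n + 1) S).comp ((Ext.mk₀ r).comp x (zero_add l)) rfl,
      fun h0 ↦ hx ?_⟩
    rw [← x.mk₀_id_comp, ← h, ← Ext.mk₀_comp_mk₀,
      Ext.comp_assoc _ _ x (add_zero 0) (zero_add l) (by lia),
      F.eq_zero_of_extClass_comp_eq_zero hS _ h0, Ext.comp_zero]

end Ext

end ProjectiveCovers

section JacobsonRadical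

variable {A : Type} [Ring A]

lemma jSmul_eq_smul {M : Type} [AddCommGroup M] [Module A M] (N : Submodule A M) :
    jSmul A N = (jrad A).asIdeal • N := by
  refine le_antisymm (Submodule.span_le.2 ?_) (Submodule.smul_le.2 fun a ha m hm ↦ ?_)
  · rintro _ ⟨a, ha, m, hm, rfl⟩
    exact Submodule.smul_mem_smul (TwoSidedIdeal.mem_asIdeal.2 ha) hm
  · exact Submodule.subset_span ⟨a, TwoSidedIdeal.mem_asIdeal.1 ha, m, hm, rfl⟩

lemma JCubeZero.mul_mul_eq_bot (h3 : JCubeZero A) :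
    (jrad A).asIdeal * (jrad A).asIdeal * (jrad A).asIdeal = ⊥ := by
  refine eq_bot_iff.2 (Ideal.mul_le.2 fun r hr z hz ↦ (Submodule.mem_bot A).2 ?_)
  have hle : (jrad A).asIdeal * (jrad A).asIdeal ≤
      LinearMap.ker (LinearMap.toSpanSingleton A A z) :=
    Ideal.mul_le.2 fun x hx y hy ↦ h3 x y z (TwoSidedIdeal.mem_asIdeal.1 hx)
      (TwoSidedIdeal.mem_asIdeal.1 hy) (TwoSidedIdeal.mem_asIdeal.1 hz)
  exact hle hr

lemma SemisimpleModJ.isSemisimpleModule (h : SemisimpleModJ A) :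
    IsSemisimpleModule A (A ⧸ (jrad A).asIdeal) := by
  let σ : A →+* (jrad A).ringCon.Quotient := (jrad A).ringCon.mk'
  have hσ (x : A) : σ x = 0 ↔ x ∈ (jrad A).asIdeal := by
    rw [TwoSidedIdeal.mem_asIdeal, TwoSidedIdeal.mem_iff]
    exact (jrad A).ringCon.eq
  have : RingHomSurjective σ := ⟨(jrad A).ringCon.mk'_surjective⟩
  let f : A →ₛₗ[σ] (jrad A).ringCon.Quotient :=
    { toFun := σ, map_add' := map_add σ, map_smul' := map_mul σ }
  let g : A ⧸ (jrad A).asIdeal →ₛₗ[σ] (jrad A).ringCon.Quotient :=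
    (jrad A).asIdeal.liftQ f fun x hx ↦ (hσ x).2 hx
  have hg : Function.Bijective g := by
    refine ⟨?_, fun y ↦ ?_⟩
    · rw [← LinearMap.ker_eq_bot]
      exact Submodule.ker_liftQ_eq_bot _ _ _ fun x hx ↦ (hσ x).1 hx
    · obtain ⟨x, rfl⟩ := (jrad A).ringCon.mk'_surjective y
      exact ⟨Submodule.Quotient.mk x, rfl⟩
  exact (LinearMap.isSemisimpleModule_iff_of_bijective g hg).2 h

lemma ProjectiveCovers.isNthSyzygy_iterSyzygy (F : ProjectiveCovers (jrad A).asIdeal) (n : ℕ)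
    (M : ModuleCat.{0} A) : IsNthSyzygy A n M (F.iterSyzygy n M) := by
  induction n with
  | zero => exact ⟨.refl A M⟩
  | succ n ih =>
    refine ⟨_, ih, F.P _, F.π _, F.projective _, F.surjective _, ?_, ?_⟩
    · rw [jSmul_eq_smul]
      exact F.ker_le _
    · rw [F.iterSyzygy_succ]
      exact ⟨.refl A _⟩

lemma ProjectiveCovers.isGood_iterSyzygy (F : ProjectiveCovers (jrad A).asIdeal)
    (hss : SemisimpleModJ A) (h3 : JCubeZero A)
    {S : ModuleCat.{0} A} (hS : IsSimpleModule A S)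
    (hvan : ∃ m : ℕ, ∀ n : ℕ, m ≤ n → Subsingleton (Abelian.Ext S S n))
    (hmin : ∀ T : ModuleCat.{0} A, IsSimpleModule A T → Preceq A T S → Nonempty (T ≃ₗ[A] S))
    (n : ℕ) : F.IsGood (F.iterSyzygy n S) := by
  have := hss.isSemisimpleModule
  by_contra h
  obtain ⟨T, r, hT, hr⟩ : ∃ (T : Submodule A (F.iterSyzygy (n + 1) S))
      (r : F.iterSyzygy (n + 1) S →ₗ[A] T), IsSimpleModule A T ∧ ∀ x : T, r x = x := by
    rw [F.iterSyzygy_succ]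
    exact F.exists_simple_retract_of_not_isGood h3.mul_mul_eq_bot h
  obtain ⟨e⟩ := hmin (ModuleCat.of A T) hT ⟨n + 1, _, F.isNthSyzygy_iterSyzygy _ _, T,
    LinearMap.ker r, LinearMap.isCompl_of_proj hr, ⟨.refl A _⟩⟩
  obtain ⟨m, hm⟩ := hvan
  have := IsSimpleModule.nontrivial A S
  let ι : S →ₗ[A] F.iterSyzygy (n + 1) S := T.subtype ∘ₗ e.symm.toLinearMap
  have hι : ModuleCat.ofHom ι ≫ ModuleCat.ofHom (e.toLinearMap ∘ₗ r) = 𝟙 S := by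
    ext x
    exact (congrArg e (hr _)).trans (e.apply_symm_apply x)
  obtain ⟨l, hl, hl'⟩ := F.exists_not_subsingleton_ext_self
    (IsSimpleModule.smul_top_eq_bot h3.mul_mul_eq_bot) hι m
  exact hl' (hm l hl)

lemma exists_subsingleton_ext_finsupp (hss : SemisimpleModJ A) (h3 : JCubeZero A)
    (hvan : ∀ T : ModuleCat.{0} A, IsSimpleModule A T →
      ∃ m : ℕ, ∀ n : ℕ, m ≤ n → Subsingleton (Abelian.Ext T T n))
    {N : ℕ} {T : Fin N → ModuleCat.{0} A} (hT : ∀ t, IsSimpleModule A (T t)) :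
    ∃ m : ℕ, ∀ t (I I' : Type) (k : ℕ), m ≤ k →
      Subsingleton (Abelian.Ext (ModuleCat.of A (I →₀ T t)) (ModuleCat.of A (I' →₀ T t)) k) := by
  have := hss.isSemisimpleModule
  choose m hm using fun t ↦ hvan (T t) (hT t)
  refine ⟨Finset.univ.sup m + 1, fun t I I' k hk ↦ ?_⟩
  obtain ⟨k, rfl⟩ := Nat.exists_eq_add_of_le' (le_of_add_le_right hk)
  have hmt : m t ≤ Finset.univ.sup m := Finset.le_sup (Finset.mem_univ t)
  have := hT t
  exact subsingleton_ext_finsupp_finsupp I I' (IsSimpleModule.smul_top_eq_bot h3.mul_mul_eq_bot)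
    (hm t _ (by lia))

lemma projDim_ne_top_of_projDimLE {M : ModuleCat.{0} A} {n : ℕ} (h : projDimLE A M n) :
    projDim A M ≠ ⊤ :=
  ne_top_of_le_ne_top (ENat.natCast_ne_top n) (sInf_le ⟨n, rfl, h⟩)

lemma ProjectiveCovers.projDimLE_of_subsingleton {J : Ideal A} (F : ProjectiveCovers J)
    {M : ModuleCat.{0} A} {n : ℕ} (h : Subsingleton (F.iterSyzygy n M)) : projDimLE A M n := by
  intro Y k hk
  refine subsingleton_of_forall_eq 0 fun x ↦ ?_
  obtain ⟨j, rfl⟩ := Nat.exists_eq_add_of_lt hk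
  obtain ⟨y, rfl⟩ := F.exists_extClass_comp_eq (n := n) (k := j) rfl x
  have h0 : 𝟙 (F.iterSyzygy n M) = 0 := (ModuleCat.isZero_of_subsingleton _).eq_of_src _ _
  rw [← y.mk₀_id_comp, h0, Abelian.Ext.mk₀_zero, Abelian.Ext.zero_comp, Abelian.Ext.comp_zero]

end JacobsonRadical

/-- Over a ring with `A/J` semisimple and `J³ = 0`, assuming `Ext^n(T, T) = 0`
for all simple `T` and `n ≫ 0`, every simple module which is minimal for the
order `⪯` (given by being a direct summand of a syzygy) has finite projective
dimension. -/
theorem stmt_17 (A : Type) [Ring A] (hss : SemisimpleModJ A) (h3 : JCubeZero A)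
    (hvan : ∀ T : ModuleCat.{0} A, IsSimpleModule A T →
      ∃ m : ℕ, ∀ n : ℕ, m ≤ n → Subsingleton (Abelian.Ext T T n))
    (S : ModuleCat.{0} A) (hS : IsSimpleModule A S)
    (hmin : ∀ T : ModuleCat.{0} A, IsSimpleModule A T → Preceq A T S →
      Nonempty (T ≃ₗ[A] S)) :
    projDim A S ≠ ⊤ := by
  have hss' := hss.isSemisimpleModule
  have h3' := h3.mul_mul_eq_bot
  obtain ⟨F⟩ := ProjectiveCovers.nonempty h3'
  obtain ⟨N, T, hT, hdecomp⟩ := exists_simple_family A (jrad A).asIdeal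
  obtain ⟨m, hm⟩ := exists_subsingleton_ext_finsupp hss h3 hvan hT
  obtain ⟨z, hz, hzq⟩ := F.exists_isYonedaChain (n := N * m) fun i _ ↦
    F.isGood_iterSyzygy hss h3 hS (hvan S hS) hmin i
  rw [hz.eq_zero hdecomp hm (ProjectiveCovers.smul_top_top_eq_bot S), Abelian.Ext.comp_zero] at hzq
  have hq := F.eq_zero_of_extClass_comp_eq_zero (ProjectiveCovers.smul_top_top_eq_bot _) _ hzq
  rw [Abelian.Ext.mk₀_eq_zero_iff] at hq
  exact projDim_ne_top_of_projDimLE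
    (F.projDimLE_of_subsingleton (ProjectiveCovers.subsingleton_of_toTop_eq_zero h3' hq))

end
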